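/- Let H₁ and H₂ be two disjoint well-linked sets in a graph G, and suppose A ⊆ H₁ is routable to B ⊆ H₂. Then for any A' ⊆ H₁ and B' ⊆ H₂ with |A'| = |B'| ≤ |A|/3, the set A' is routable to B' in G. -/

import Mathlib

open Finset

/-- Count of occurrences of `e` in a list (classical, no decidability assumptions). -/
noncomputable def ecount {α : Type} (l : List α) (e : α) : ℕ :=
  letI := Classical.decEq α
  l.count e

/-- The number of edges of `G` with exactly one endpoint in `S`, i.e. `|δ(S)|`. -/
noncomputable def edgeCut {V : Type} (G : SimpleGraph V) (S : Set V) : ℕ :=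
  {e ∈ G.edgeSet | ∃ u v, e = s(u, v) ∧ u ∈ S ∧ v ∉ S}.ncard

/-- `X` is (cut-)well-linked in `G`: `|δ(S)| ≥ |S ∩ X|` whenever `|S ∩ X| ≤ |X|/2`. -/
def WellLinked {V : Type} [DecidableEq V] (G : SimpleGraph V) (X : Finset V) : Prop :=
  ∀ S : Finset V, 2 * (S ∩ X).card ≤ X.card → (S ∩ X).card ≤ edgeCut G ↑S

/-- `S` is routable to `T` in `G`: there are `|S|` pairwise edge-disjoint paths from `S`
to `T` such that every vertex of `S ∪ T` is an endpoint of at most one of the paths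
(paths of length 0 are allowed). -/
def Routable {V : Type} (G : SimpleGraph V) (S T : Finset V) : Prop :=
  ∃ (f : V → V) (P : ∀ s ∈ S, G.Walk s (f s)),
    (∀ s ∈ S, f s ∈ T) ∧
    Set.InjOn f ↑S ∧
    (∀ s ∈ S, ∀ s' ∈ S, f s = s' → s = s') ∧
    ∀ e : Sym2 V, (∑ a ∈ S.attach, ecount (P a.1 a.2).edges e) ≤ 1

/-- The maximum number of pairwise edge-disjoint paths from `A` to `B` in `G` (with
every vertex of `A ∪ B` the endpoint of at most one path). -/
noncomputable def maxEDPaths {V : Type} (G : SimpleGraph V) (A B : Finset V) : ℕ :=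
  sSup {r : ℕ | ∃ A' ⊆ A, A'.card = r ∧ Routable G A' B}

open SimpleGraph

/-- An antisymmetric integral flow on the edges of `G`, each of capacity one. -/
structure UnitFlow {V : Type} (G : SimpleGraph V) (f : V → V → ℤ) : Prop where
  antisymm : ∀ x y, f x y = -f y x
  le_one : ∀ x y, f x y ≤ 1
  support : ∀ x y, ¬ G.Adj x y → f x y = 0

section
variable {V : Type} {G : SimpleGraph V}

/-- Vertices reachable from `v` along edges of `G` on which `Q` holds in the direction traversed. -/
def reachSet (G : SimpleGraph V) (Q : V → V → Prop) (v : V) : Set V :=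
  {w | ∃ p : G.Walk v w, ∀ d ∈ p.darts, Q d.fst d.snd}

lemma self_mem_reachSet (Q : V → V → Prop) (v : V) : v ∈ reachSet G Q v :=
  ⟨.nil, by simp⟩

lemma mem_reachSet_of_adj {Q : V → V → Prop} {v x y : V} (hx : x ∈ reachSet G Q v)
    (h : G.Adj x y) (hQ : Q x y) : y ∈ reachSet G Q v := by
  obtain ⟨p, hp⟩ := hx
  refine ⟨p.concat h, fun d hd => ?_⟩
  rw [Walk.darts_concat, List.concat_eq_append, List.mem_append, List.mem_singleton] at hd
  rcases hd with hd | rfl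
  · exact hp d hd
  · exact hQ

lemma UnitFlow.neg_one_le {f : V → V → ℤ} (hf : UnitFlow G f) (x y : V) : -1 ≤ f x y := by
  have := hf.antisymm x y
  have := hf.le_one y x
  lia

lemma edgeCut_compl (S : Set V) : edgeCut G Sᶜ = edgeCut G S := by
  unfold edgeCut
  congr 1
  ext e
  simp only [Set.mem_ofPred_eq, Set.mem_compl_iff, not_not]
  constructor <;> rintro ⟨he, u, v, rfl, hu, hv⟩ <;> exact ⟨he, v, u, Sym2.eq_swap, hv, hu⟩

/-- The unit flow along a walk, as a net count of the darts it traverses. -/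
def walkFlow [DecidableEq V] : ∀ {u v : V}, G.Walk u v → V → V → ℤ
  | _, _, .nil => fun _ _ => 0
  | u, _, .cons (v := w) _ p => fun x y =>
      (if x = u ∧ y = w then 1 else 0) - (if x = w ∧ y = u then 1 else 0) + walkFlow p x y

variable [DecidableEq V]

lemma walkFlow_antisymm {u v : V} (p : G.Walk u v) (x y : V) :
    walkFlow p x y = -walkFlow p y x := by
  induction p with
  | nil => simp [walkFlow]
  | cons h p ih =>
    simp only [walkFlow]
    rw [ih]
    simp only [and_comm]
    ring

lemma sum_walkFlow [Fintype V] {u v : V} (p : G.Walk u v) (x : V) :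
    ∑ y, walkFlow p x y = (if x = u then 1 else 0) - (if x = v then 1 else 0) := by
  induction p with
  | nil => simp [walkFlow]
  | cons h p ih =>
    simp only [walkFlow, sum_add_distrib, sum_sub_distrib, ih, ite_and]
    split_ifs <;> simp

lemma walkFlow_of_notMem_edges {u v : V} (p : G.Walk u v) (x y : V) (h : s(x, y) ∉ p.edges) :
    walkFlow p x y = 0 := by
  induction p with
  | nil => rfl
  | cons hadj p ih =>
    simp only [Walk.edges_cons, List.mem_cons, not_or, Sym2.eq_iff] at h
    simp only [walkFlow, ih h.2]
    grind

lemma walkFlow_of_mem_darts {u v : V} (p : G.Walk u v) (hp : p.edges.Nodup) (d : G.Dart)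
    (hd : d ∈ p.darts) : walkFlow p d.fst d.snd = 1 := by
  induction p with
  | nil => simp at hd
  | @cons a b c hadj p ih =>
    simp only [Walk.edges_cons, List.nodup_cons] at hp
    simp only [Walk.darts_cons, List.mem_cons] at hd
    have hne := hadj.ne
    rcases hd with rfl | hd
    · simp [walkFlow, walkFlow_of_notMem_edges p a b hp.1, hne]
    · have hmem : d.edge ∈ p.edges := List.mem_map_of_mem hd
      have hdab : d.edge ≠ s(a, b) := fun h => hp.1 (h ▸ hmem)
      have hde : d.edge = s(d.fst, d.snd) := rfl
      rw [hde, ne_eq, Sym2.eq_iff] at hdab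
      simp only [walkFlow, ih hp.2 hd]
      grind

/-- A walk along whose darts `Q` holds can be shortened to a trail; its flow is `1` along
the darts and `-1` against them. -/
lemma exists_trail_walkFlow {u v : V} (Q : V → V → Prop) (p : G.Walk u v)
    (hp : ∀ d ∈ p.darts, Q d.fst d.snd) :
    ∃ q : G.Walk u v, q.edges.Nodup ∧ (∀ x y, s(x, y) ∈ q.edges →
      (walkFlow q x y = 1 ∧ Q x y) ∨ (walkFlow q x y = -1 ∧ Q y x)) := by
  refine ⟨p.bypass, p.bypass_isPath.isTrail.edges_nodup, fun x y hxy => ?_⟩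
  obtain ⟨d, hd, hde⟩ := List.mem_map.1 hxy
  have h1 := walkFlow_of_mem_darts _ p.bypass_isPath.isTrail.edges_nodup d hd
  have h2 := hp d (p.darts_bypass_subset_darts hd)
  have hde : s(d.fst, d.snd) = s(x, y) := hde
  rw [Sym2.eq_iff] at hde
  rcases hde with ⟨rfl, rfl⟩ | ⟨rfl, rfl⟩
  · exact .inl ⟨h1, h2⟩
  · right
    rw [walkFlow_antisymm, h1]
    exact ⟨rfl, h2⟩

/-- The net flow out of a set only depends on the flow across its boundary. -/
lemma UnitFlow.sum_excess [Fintype V] {f : V → V → ℤ} (hf : UnitFlow G f) (R : Finset V) :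
    ∑ x ∈ R, ∑ y, f x y = ∑ x ∈ R, ∑ y ∈ Rᶜ, f x y := by
  have h0 : ∑ x ∈ R, ∑ y ∈ R, f x y = 0 := by
    have h : ∑ x ∈ R, ∑ y ∈ R, f x y = -∑ x ∈ R, ∑ y ∈ R, f x y := by
      conv_lhs => rw [sum_comm]
      rw [← sum_neg_distrib]
      refine sum_congr rfl fun x _ => ?_
      rw [← sum_neg_distrib]
      exact sum_congr rfl fun y _ => hf.antisymm _ _
    lia
  calc _ = ∑ x ∈ R, (∑ y ∈ R, f x y + ∑ y ∈ Rᶜ, f x y) :=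
        sum_congr rfl fun x _ => (sum_add_sum_compl R _).symm
    _ = _ := by rw [sum_add_distrib, h0, zero_add]

/-- A saturated cut carries at least `|δ(R)|` units of flow. -/
lemma UnitFlow.edgeCut_le_of_saturated [Fintype V] {f : V → V → ℤ} (hf : UnitFlow G f)
    (R : Finset V) (hR : ∀ x ∈ R, ∀ y ∉ R, G.Adj x y → f x y = 1) :
    (edgeCut G R : ℤ) ≤ ∑ x ∈ R, ∑ y, f x y := by
  classical
  rw [hf.sum_excess, ← sum_product']
  have hsum : ∑ z ∈ R ×ˢ Rᶜ, f z.1 z.2 = ((R ×ˢ Rᶜ).filter fun z => G.Adj z.1 z.2).card := by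
    rw [card_filter, Nat.cast_sum]
    refine sum_congr rfl fun z hz => ?_
    simp only [mem_product, mem_compl] at hz
    by_cases h : G.Adj z.1 z.2
    · simp [h, hR _ hz.1 _ hz.2 h]
    · simp [h, hf.support _ _ h]
  rw [hsum, Nat.cast_le, edgeCut]
  have hsub : {e ∈ G.edgeSet | ∃ u v, e = s(u, v) ∧ u ∈ (R : Set V) ∧ v ∉ (R : Set V)} ⊆
      ((((R ×ˢ Rᶜ).filter fun z => G.Adj z.1 z.2).image fun z => s(z.1, z.2) : Finset (Sym2 V)) :
        Set (Sym2 V)) := by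
    rintro e ⟨he, u, v, rfl, hu, hv⟩
    simp only [coe_image, Set.mem_image, coe_filter, Set.mem_ofPred_eq, mem_product, mem_compl]
    exact ⟨(u, v), ⟨⟨by simpa using hu, by simpa using hv⟩, he⟩, rfl⟩
  refine (Set.ncard_le_ncard hsub (Finset.finite_toSet _)).trans ?_
  rw [Set.ncard_coe_finset]
  exact card_image_le

lemma UnitFlow.sum_excess_univ [Fintype V] {f : V → V → ℤ} (hf : UnitFlow G f) :
    ∑ x, ∑ y, f x y = 0 := by
  rw [hf.sum_excess]; simp

/-- Integral max-flow min-cut for unit capacities, in supply-demand form: if every cut has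
capacity at least its net supply, some unit flow meets the supply exactly. -/
theorem exists_unitFlow [Fintype V] (d : V → ℤ) (hd : ∑ x, d x = 0)
    (hcut : ∀ S : Finset V, ∑ x ∈ S, d x ≤ edgeCut G S) :
    ∃ f, UnitFlow G f ∧ ∀ x, ∑ y, f x y = d x := by
  classical
  suffices H : ∀ n : ℕ, ∀ f, UnitFlow G f → ∑ x, |d x - ∑ y, f x y| = n →
      ∃ f, UnitFlow G f ∧ ∀ x, ∑ y, f x y = d x by
    refine H (∑ x, |d x|).toNat (fun _ _ => 0) ⟨by simp, by simp, by simp⟩ ?_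
    simp [Int.toNat_of_nonneg (sum_nonneg fun x _ => abs_nonneg (d x))]
  intro n
  induction n using Nat.strong_induction_on with
  | _ n ih =>
  intro f hf hn
  by_cases hpos : ∃ v, 0 < d v - ∑ y, f v y
  swap
  · push Not at hpos
    refine ⟨f, hf, fun x => ?_⟩
    have hz : ∑ x, (d x - ∑ y, f x y) = 0 := by
      rw [sum_sub_distrib, hd, hf.sum_excess_univ, sub_zero]
    have := (sum_eq_zero_iff_of_nonpos fun x _ => hpos x).1 hz x (mem_univ x)
    lia
  obtain ⟨v, hv⟩ := hpos
  set R : Finset V := (reachSet G (fun x y => f x y < 1) v).toFinset with hRdef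
  have hmem : ∀ x, x ∈ R ↔ x ∈ reachSet G (fun x y => f x y < 1) v := by simp [hRdef]
  have hvR : v ∈ R := (hmem v).2 (self_mem_reachSet _ v)
  have hsat := hf.edgeCut_le_of_saturated R fun x hx y hy hadj => by
    by_contra hne
    exact hy ((hmem y).2 (mem_reachSet_of_adj ((hmem x).1 hx) hadj
      (lt_of_le_of_ne (hf.le_one x y) hne)))
  obtain ⟨w, hwR, hw⟩ : ∃ w ∈ R, d w - ∑ y, f w y < 0 := by
    by_contra! hcon
    have h1 : 0 < ∑ x ∈ R, (d x - ∑ y, f x y) := sum_pos' hcon ⟨v, hvR, hv⟩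
    rw [sum_sub_distrib] at h1
    have := hcut R
    lia
  have hvw : v ≠ w := by rintro rfl; lia
  obtain ⟨p, hp⟩ := (hmem w).1 hwR
  obtain ⟨q, -, hq⟩ := exists_trail_walkFlow (fun x y => f x y < 1) p hp
  have hex : ∀ x, ∑ y, (f x y + walkFlow q x y) =
      ∑ y, f x y + ((if x = v then 1 else 0) - (if x = w then 1 else 0)) := fun x => by
    rw [sum_add_distrib, sum_walkFlow]
  have hlt : ∑ x, |d x - ∑ y, (f x y + walkFlow q x y)| < n := by
    rw [← hn]
    refine sum_lt_sum (fun x _ => ?_) ⟨v, mem_univ v, ?_⟩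
    · rw [hex]
      by_cases hxv : x = v
      · subst hxv
        simp only [if_neg hvw, if_true]
        rw [abs_of_nonneg (by lia), abs_of_pos hv]
        lia
      · by_cases hxw : x = w
        · subst hxw
          simp only [if_neg hxv, if_true]
          rw [abs_of_nonpos (by lia), abs_of_neg hw]
          lia
        · simp [hxv, hxw]
    · rw [hex]
      simp only [if_neg hvw, if_true]
      rw [abs_of_nonneg (by lia), abs_of_pos hv]
      lia
  have hnn : 0 ≤ ∑ x, |d x - ∑ y, (f x y + walkFlow q x y)| := sum_nonneg fun _ _ => abs_nonneg _
  refine ih (∑ x, |d x - ∑ y, (f x y + walkFlow q x y)|).toNat (by lia)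
    (fun x y => f x y + walkFlow q x y) ⟨fun x y => ?_, fun x y => ?_, fun x y hxy => ?_⟩
    (by simp [Int.toNat_of_nonneg hnn])
  · rw [walkFlow_antisymm, hf.antisymm]; ring
  · by_cases hxy : s(x, y) ∈ q.edges
    · rcases hq x y hxy with h | h
      · lia
      · have := hf.le_one x y; lia
    · rw [walkFlow_of_notMem_edges q x y hxy, add_zero]; exact hf.le_one x y
  · rw [hf.support x y hxy, walkFlow_of_notMem_edges q x y fun h => hxy (q.adj_of_mem_edges h),
      add_zero]

/-- Decomposition of a unit flow from `A` to `B` into edge-disjoint trails. -/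
theorem UnitFlow.exists_trails [Fintype V] (A : Finset V) : ∀ (B : Finset V) (f : V → V → ℤ),
    UnitFlow G f → Disjoint A B →
    (∀ x, ∑ y, f x y = (if x ∈ A then 1 else 0) - (if x ∈ B then 1 else 0)) →
    ∃ (g : V → V) (L : V → List (Sym2 V)),
      (∀ s ∈ A, ∃ p : G.Walk s (g s), p.edges = L s) ∧ (∀ s ∈ A, g s ∈ B) ∧
      Set.InjOn g A ∧ ∀ x y, ((∑ s ∈ A, (L s).count s(x, y) : ℕ) : ℤ) ≤ |f x y| := by
  classical
  induction A using Finset.induction_on with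
  | empty => exact fun B f _ _ _ => ⟨id, fun _ => [], by simp⟩
  | insert a A ha ih =>
  intro B f hf hdisj hex
  rw [disjoint_insert_left] at hdisj
  set R : Finset V := (reachSet G (fun x y => f x y = 1) a).toFinset with hRdef
  have hmem : ∀ x, x ∈ R ↔ x ∈ reachSet G (fun x y => f x y = 1) a := by simp [hRdef]
  have haR : a ∈ R := (hmem a).2 (self_mem_reachSet _ a)
  obtain ⟨b, hbR, hbB⟩ : ∃ b ∈ R, b ∈ B := by
    by_contra! hcon
    have h1 : 0 < ∑ x ∈ R, ∑ y, f x y := by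
      refine sum_pos' (fun x hx => ?_) ⟨a, haR, ?_⟩
      · rw [hex, if_neg (hcon x hx)]; split_ifs <;> simp
      · rw [hex, if_neg (hcon a haR)]; simp
    rw [hf.sum_excess] at h1
    refine h1.not_ge (sum_nonpos fun x hx => sum_nonpos fun y hy => ?_)
    by_contra! hlt
    have hadj : G.Adj x y := by
      by_contra hadj
      rw [hf.support x y hadj] at hlt
      exact lt_irrefl _ hlt
    have := hf.le_one x y
    exact (mem_compl.1 hy) ((hmem y).2 (mem_reachSet_of_adj ((hmem x).1 hx) hadj (by lia)))
  obtain ⟨p, hp⟩ := (hmem b).1 hbR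
  obtain ⟨q, hnodup, hq⟩ := exists_trail_walkFlow (fun x y => f x y = 1) p hp
  have hab : a ≠ b := fun h => hdisj.1 (h ▸ hbB)
  have habs : ∀ x y, s(x, y) ∈ q.edges → f x y - walkFlow q x y = 0 ∧ |f x y| = 1 := by
    intro x y hxy
    have := hf.antisymm x y
    rcases hq x y hxy with ⟨h1, h2⟩ | ⟨h1, h2⟩
    · simp [h1, h2]
    · rw [h2] at this
      simp [h1, this]
  have hflow : UnitFlow G fun x y => f x y - walkFlow q x y := by
    refine ⟨fun x y => ?_, fun x y => ?_, fun x y hxy => ?_⟩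
    · rw [walkFlow_antisymm, hf.antisymm]; ring
    · by_cases hxy : s(x, y) ∈ q.edges
      · simp [(habs x y hxy).1]
      · rw [walkFlow_of_notMem_edges q x y hxy, sub_zero]; exact hf.le_one x y
    · rw [hf.support x y hxy, walkFlow_of_notMem_edges q x y fun h => hxy (q.adj_of_mem_edges h),
        sub_zero]
  obtain ⟨g, L, hL, hgB, hinj, hcount⟩ := ih (B.erase b) _ hflow
    (hdisj.2.mono_right (erase_subset _ _)) fun x => by
      rw [sum_sub_distrib, sum_walkFlow, hex]
      by_cases hxa : x = a
      · subst hxa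
        simp [ha, hab]
      · by_cases hxb : x = b
        · subst hxb
          simp [hxa, hbB]
        · simp [hxa, hxb]
  have hne : ∀ s ∈ A, s ≠ a := fun s hs h => ha (h ▸ hs)
  refine ⟨Function.update g a b, Function.update L a q.edges, fun s hs => ?_, fun s hs => ?_, ?_,
    fun x y => ?_⟩
  · rcases mem_insert.1 hs with rfl | hs
    · rw [Function.update_self, Function.update_self]; exact ⟨q, rfl⟩
    · rw [Function.update_of_ne (hne s hs), Function.update_of_ne (hne s hs)]; exact hL s hs
  · rcases mem_insert.1 hs with rfl | hs
    · rwa [Function.update_self]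
    · rw [Function.update_of_ne (hne s hs)]; exact mem_of_mem_erase (hgB s hs)
  · intro s hs t ht hst
    rcases mem_insert.1 (mem_coe.1 hs) with rfl | hsA <;>
      rcases mem_insert.1 (mem_coe.1 ht) with rfl | htA
    · rfl
    · rw [Function.update_self, Function.update_of_ne (hne t htA)] at hst
      exact absurd hst.symm (ne_of_mem_erase (hgB t htA))
    · rw [Function.update_self, Function.update_of_ne (hne s hsA)] at hst
      exact absurd hst (ne_of_mem_erase (hgB s hsA))
    · rw [Function.update_of_ne (hne s hsA), Function.update_of_ne (hne t htA)] at hst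
      exact hinj hsA htA hst
  · rw [sum_insert ha, Function.update_self,
      sum_congr rfl fun s hs => by rw [Function.update_of_ne (hne s hs)]]
    have := hcount x y
    by_cases hxy : s(x, y) ∈ q.edges
    · rw [(habs x y hxy).1] at this
      rw [(habs x y hxy).2, List.count_eq_one_of_mem hnodup hxy]
      simp only [abs_zero] at this
      push_cast at this ⊢
      lia
    · rw [walkFlow_of_notMem_edges q x y hxy, sub_zero] at this
      rwa [List.count_eq_zero_of_not_mem hxy, zero_add]

/-- Menger's theorem for edge-disjoint paths between disjoint sets of equal size. -/
theorem routable_of_edgeCut [Fintype V] (A B : Finset V) (hdisj : Disjoint A B)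
    (hcard : A.card = B.card)
    (hcut : ∀ S : Finset V, (S ∩ A).card ≤ edgeCut G S + (S ∩ B).card) : Routable G A B := by
  classical
  obtain ⟨f, hf, hex⟩ := exists_unitFlow (G := G)
    (fun x => (if x ∈ A then 1 else 0) - (if x ∈ B then 1 else 0))
    (by simp [sum_sub_distrib, hcard])
    (fun S => by
      have := hcut S
      simp only [sum_sub_distrib, sum_boole, filter_mem_eq_inter]
      lia)
  obtain ⟨g, L, hL, hgB, hinj, hcount⟩ := hf.exists_trails A B f hdisj hex
  choose P hP using hL
  refine ⟨g, P, hgB, hinj,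
    fun s hs t ht h => absurd (h ▸ hgB s hs) (disjoint_left.1 hdisj ht), fun e => ?_⟩
  induction e with
  | _ x y =>
  have hsum : ∑ a ∈ A.attach, ecount (P a.1 a.2).edges s(x, y) =
      ∑ s ∈ A, (L s).count s(x, y) := by
    rw [← sum_attach A]
    refine sum_congr rfl fun a _ => ?_
    rw [hP, ecount]
    congr!
  have h1 := hcount x y
  have h2 : |f x y| ≤ 1 := abs_le.2 ⟨hf.neg_one_le x y, hf.le_one x y⟩
  rw [hsum]
  lia

/-- Every cut is crossed by the paths of a routing that start in it and end outside. -/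
lemma Routable.card_le_edgeCut [Fintype V] {A B : Finset V} (h : Routable G A B) (S : Finset V) :
    (S ∩ A).card ≤ edgeCut G S + (S ∩ B).card := by
  classical
  obtain ⟨f, P, hfB, hinj, -, hcount⟩ := h
  have hback : ((S ∩ A).filter fun s => f s ∈ S).card ≤ (S ∩ B).card := by
    refine card_le_card_of_injOn f (fun s hs => ?_) (hinj.mono fun s hs => ?_)
    · simp only [coe_filter, mem_inter, Set.mem_ofPred_eq] at hs
      simpa using ⟨hs.2, hfB s hs.1.2⟩
    · simp only [coe_filter, mem_inter, Set.mem_ofPred_eq] at hs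
      exact hs.1.2
  have hcross : ((S ∩ A).filter fun s => ¬ f s ∈ S).card ≤ edgeCut G S := by
    have key : ∀ s : V, ∃ e : Sym2 V, ∀ hs : s ∈ A, s ∈ S → f s ∉ S → e ∈ (P s hs).edges ∧
        e ∈ {e ∈ G.edgeSet | ∃ u v, e = s(u, v) ∧ u ∈ (S : Set V) ∧ v ∉ (S : Set V)} := by
      intro s
      by_cases hs : s ∈ A ∧ s ∈ S ∧ f s ∉ S
      · obtain ⟨d, hd, h1, h2⟩ :=
          (P s hs.1).exists_boundary_dart (S : Set V) (mem_coe.2 hs.2.1) (by simpa using hs.2.2)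
        exact ⟨d.edge, fun _ _ _ => ⟨List.mem_map_of_mem hd, d.edge_mem, _, _, rfl, h1, h2⟩⟩
      · exact ⟨s(s, s), fun h1 h2 h3 => absurd ⟨h1, h2, h3⟩ hs⟩
    choose e he using key
    rw [edgeCut, ← Set.ncard_coe_finset]
    refine Set.ncard_le_ncard_of_injOn e (fun s hs => ?_) (fun s hs t ht hst => ?_)
      (Set.toFinite _)
    · simp only [coe_filter, mem_inter, Set.mem_ofPred_eq] at hs
      exact (he s hs.1.2 hs.1.1 hs.2).2
    · simp only [coe_filter, mem_inter, Set.mem_ofPred_eq] at hs ht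
      by_contra hne
      have h1 := (he s hs.1.2 hs.1.1 hs.2).1
      have h2 := (he t ht.1.2 ht.1.1 ht.2).1
      rw [← hst] at h2
      have h3 : ∑ a ∈ ({⟨s, hs.1.2⟩, ⟨t, ht.1.2⟩} : Finset {x // x ∈ A}),
          ecount (P a.1 a.2).edges (e s) ≤ 1 :=
        (sum_le_sum_of_subset fun a _ => mem_attach A a).trans (hcount (e s))
      rw [sum_pair (by simpa using hne)] at h3
      have h4 : 0 < ecount (P s hs.1.2).edges (e s) := by
        simpa [ecount] using h1
      have h5 : 0 < ecount (P t ht.1.2).edges (e s) := by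
        simpa [ecount] using h2
      lia
  rw [← card_filter_add_card_filter_not (s := S ∩ A) fun s => f s ∈ S]
  lia

/-- The smaller side of any cut meets a well-linked set in at most `|δ(S)|` vertices. -/
lemma WellLinked.le_edgeCut_or [Fintype V] {H : Finset V} (h : WellLinked G H) (S : Finset V) :
    (S ∩ H).card ≤ edgeCut G S ∨ (H \ S).card ≤ edgeCut G S := by
  have hc : Sᶜ ∩ H = H \ S := by ext; simp [and_comm]
  have hadd := card_sdiff_add_card_inter H S
  rw [inter_comm] at hadd
  by_cases hS : 2 * (S ∩ H).card ≤ H.card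
  · exact .inl (h S hS)
  · have := h Sᶜ (by rw [hc]; lia)
    rw [coe_compl, edgeCut_compl, hc] at this
    exact .inr this

end

/-- **Rerouting both sides between two well-linked sets (Lemma `lem:alltoall2`).** Let
`H₁` and `H₂` be two disjoint well-linked sets in `G`, and suppose `A ⊆ H₁` is
routable to `B ⊆ H₂`. Then any `A' ⊆ H₁` and `B' ⊆ H₂` with `|A'| = |B'| ≤ |A|/3`
satisfy that `A'` is routable to `B'` in `G`. -/
theorem reroute_both_sides
    (V : Type) [Fintype V] [DecidableEq V] (G : SimpleGraph V)
    (H₁ H₂ : Finset V) (hdisj : Disjoint H₁ H₂)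
    (h1 : WellLinked G H₁) (h2 : WellLinked G H₂)
    (A : Finset V) (hA : A ⊆ H₁) (B : Finset V) (hB : B ⊆ H₂)
    (hAB : Routable G A B)
    (A' : Finset V) (hA' : A' ⊆ H₁) (B' : Finset V) (hB' : B' ⊆ H₂)
    (hcard : A'.card = B'.card) (hthird : 3 * A'.card ≤ A.card) :
    Routable G A' B' := by
  refine routable_of_edgeCut A' B' (hdisj.mono hA' hB') hcard fun S => ?_
  have hAS : (S ∩ A').card ≤ (S ∩ H₁).card := card_le_card (inter_subset_inter_left hA')
  have hBS : (B' \ S).card ≤ (H₂ \ S).card := card_le_card (sdiff_subset_sdiff hB' subset_rfl)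
  have hAS' : (A \ S).card ≤ (H₁ \ S).card := card_le_card (sdiff_subset_sdiff hA subset_rfl)
  have hBS' : (S ∩ B).card ≤ (S ∩ H₂).card := card_le_card (inter_subset_inter_left hB)
  have hA'le : (S ∩ A').card ≤ A'.card := card_le_card inter_subset_right
  have hAadd := card_sdiff_add_card_inter A S
  have hBadd := card_sdiff_add_card_inter B' S
  rw [inter_comm] at hAadd hBadd
  have hroute := hAB.card_le_edgeCut S
  rcases h1.le_edgeCut_or S with h | h <;> rcases h2.le_edgeCut_or S with h' | h' <;> lia
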